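/- Let A be an arbitrary index set, X = c₀(A), Y a Banach space, and ω an admissible modulus. Let f ∈ VC^{0,ω}_small(X,Y) and ε > 0. Then there exist g ∈ VC^{0,ω}_small(X,Y) and r > 0 such that ‖g − f‖_{Ċ^{0,ω}(X,Y)} ≤ ε, and for every x ∈ X there exists a finite subset S = S_x of A such that g(z) = g(P_S(z)) whenever ‖z − x‖ ≤ r. Moreover, if f has bounded support then g can be taken with bounded support, and if f is Lipschitz then g can be taken Lipschitz. -/

import Mathlib

open Filter Set

/-- An admissible modulus of continuity `ω : (0,∞) → (0,∞)`: positive, non-decreasing,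
`ω(t) → 0` as `t → 0⁺`, `ω(t) → ∞` as `t → ∞`, `t/ω(t) → 0` as `t → 0⁺`, and doubling. -/
def Admissible (ω : ℝ → ℝ) : Prop :=
  (∀ t : ℝ, 0 < t → 0 < ω t) ∧
  (∀ s t : ℝ, 0 < s → s ≤ t → ω s ≤ ω t) ∧
  Tendsto ω (nhdsWithin 0 (Ioi 0)) (nhds 0) ∧
  Tendsto ω atTop atTop ∧
  Tendsto (fun t => t / ω t) (nhdsWithin 0 (Ioi 0)) (nhds 0) ∧
  ∃ C : ℝ, 1 < C ∧ ∀ t : ℝ, 0 < t → ω (2 * t) ≤ C * ω t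

section Defs

variable {X Y : Type*} [NormedAddCommGroup X] [NormedSpace ℝ X]
  [NormedAddCommGroup Y] [NormedSpace ℝ Y]

/-- `‖f‖_{Ċ^{0,ω}} ≤ M`. -/
def HolderLE (ω : ℝ → ℝ) (f : X → Y) (M : ℝ) : Prop :=
  ∀ x y : X, x ≠ y → ‖f x - f y‖ ≤ M * ω ‖x - y‖

/-- `f ∈ Ċ^{0,ω}(X,Y)`: the homogeneous Hölder seminorm is finite. -/
def HolderFinite (ω : ℝ → ℝ) (f : X → Y) : Prop :=
  ∃ M : ℝ, HolderLE ω f M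

/-- `f ∈ VC^{0,ω}_small(X,Y)`. -/
def VCsmall (ω : ℝ → ℝ) (f : X → Y) : Prop :=
  HolderFinite ω f ∧
    ∀ ε : ℝ, 0 < ε → ∃ δ : ℝ, 0 < δ ∧ ∀ x y : X, x ≠ y → ‖x - y‖ < δ →
      ‖f x - f y‖ ≤ ε * ω ‖x - y‖

/-- `f ∈ VC^{0,ω}_large(X,Y)`. -/
def VClarge (ω : ℝ → ℝ) (f : X → Y) : Prop :=
  HolderFinite ω f ∧
    ∀ ε : ℝ, 0 < ε → ∃ δ : ℝ, 0 < δ ∧ ∀ x y : X, δ < ‖x - y‖ →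
      ‖f x - f y‖ ≤ ε * ω ‖x - y‖

/-- `f ∈ VC^{0,ω}_far(X,Y)`. -/
def VCfar (ω : ℝ → ℝ) (f : X → Y) : Prop :=
  HolderFinite ω f ∧
    ∀ ε : ℝ, 0 < ε → ∃ δ : ℝ, 0 < δ ∧ ∀ x y : X, x ≠ y → δ < ‖x‖ → δ < ‖y‖ →
      ‖f x - f y‖ ≤ ε * ω ‖x - y‖

/-- `f ∈ VC^{0,ω}(X,Y)`, the intersection of the three vanishing classes. -/
def VCfull (ω : ℝ → ℝ) (f : X → Y) : Prop :=
  VCsmall ω f ∧ VClarge ω f ∧ VCfar ω f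

/-- `f` has bounded support: it vanishes outside some bounded set. -/
def BddSupp (f : X → Y) : Prop :=
  ∃ R : ℝ, ∀ x : X, R < ‖x‖ → f x = 0

end Defs

/-- Soft thresholding at level `η`: shrinks a real number towards `0` by `η`. -/
def softThreshold (η t : ℝ) : ℝ := t - max (-η) (min t η)

lemma continuous_softThreshold (η : ℝ) : Continuous (softThreshold η) := by
  unfold softThreshold; fun_prop

lemma softThreshold_eq_zero {η t : ℝ} (h : |t| ≤ η) : softThreshold η t = 0 := by
  rw [abs_le] at h
  rw [softThreshold, min_eq_left h.2, max_eq_right h.1, sub_self]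

lemma abs_softThreshold_sub_self_le {η : ℝ} (hη : 0 ≤ η) (t : ℝ) :
    |softThreshold η t - t| ≤ η := by
  have h : softThreshold η t - t = -max (-η) (min t η) := by rw [softThreshold]; ring
  rw [h, abs_neg, abs_le]
  exact ⟨le_max_left _ _, max_le (by linarith) (min_le_right _ _)⟩

lemma abs_softThreshold_sub_le {η : ℝ} (hη : 0 ≤ η) (s t : ℝ) :
    |softThreshold η s - softThreshold η t| ≤ |s - t| := by
  unfold softThreshold
  grind

namespace ZeroAtInftyContinuousMap

lemma norm_coe_le {A : Type*} [TopologicalSpace A] (x : ZeroAtInftyContinuousMap A ℝ) (a : A) :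
    |x a| ≤ ‖x‖ := by
  rw [← norm_toBCF_eq_norm]
  exact x.toBCF.norm_coe_le_norm a

lemma norm_le_of_forall_abs_le {A : Type*} [TopologicalSpace A]
    {x : ZeroAtInftyContinuousMap A ℝ} {C : ℝ} (hC : 0 ≤ C) (h : ∀ a, |x a| ≤ C) : ‖x‖ ≤ C := by
  rw [← norm_toBCF_eq_norm]
  exact (BoundedContinuousFunction.norm_le hC).2 h

lemma finite_setOf_lt_abs {A : Type*} [TopologicalSpace A] [DiscreteTopology A]
    (x : ZeroAtInftyContinuousMap A ℝ) {c : ℝ} (hc : 0 < c) : {a | c < |x a|}.Finite := by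
  have h := x.zero_at_infty'
  rw [cocompact_eq_cofinite] at h
  have h' : ∀ᶠ a in cofinite, ‖x a‖ < c := by
    simpa using h.eventually (Metric.ball_mem_nhds 0 hc)
  exact (eventually_cofinite.1 h').subset fun a ha => not_lt.2 (le_of_lt ha)

/-- Coordinatewise soft thresholding. -/
def shrink {A : Type*} [TopologicalSpace A] {η : ℝ} (hη : 0 ≤ η)
    (x : ZeroAtInftyContinuousMap A ℝ) : ZeroAtInftyContinuousMap A ℝ where
  toFun a := softThreshold η (x a)
  continuous_toFun := (continuous_softThreshold η).comp x.continuous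
  zero_at_infty' := by
    have h := ((continuous_softThreshold η).tendsto 0).comp x.zero_at_infty'
    rwa [softThreshold_eq_zero (by simpa using hη)] at h

section shrink

variable {A : Type*} [TopologicalSpace A] {η : ℝ} (hη : 0 ≤ η)

lemma shrink_apply (x : ZeroAtInftyContinuousMap A ℝ) (a : A) :
    shrink hη x a = softThreshold η (x a) := rfl

lemma norm_shrink_sub_self_le (x : ZeroAtInftyContinuousMap A ℝ) : ‖shrink hη x - x‖ ≤ η :=
  norm_le_of_forall_abs_le hη fun a => abs_softThreshold_sub_self_le hη (x a)

lemma norm_shrink_sub_le (x y : ZeroAtInftyContinuousMap A ℝ) :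
    ‖shrink hη x - shrink hη y‖ ≤ ‖x - y‖ :=
  norm_le_of_forall_abs_le (norm_nonneg _) fun a =>
    (abs_softThreshold_sub_le hη (x a) (y a)).trans (norm_coe_le (x - y) a)

lemma lipschitzWith_shrink : LipschitzWith 1 (shrink (A := A) hη) :=
  LipschitzWith.of_dist_le_mul fun x y => by
    simpa [dist_eq_norm] using norm_shrink_sub_le hη x y

/-- On balls of radius `η / 2`, soft thresholding depends on finitely many coordinates. -/
lemma exists_finset_shrink_eq [DiscreteTopology A] (hη' : 0 < η)
    (x : ZeroAtInftyContinuousMap A ℝ) :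
    ∃ S : Finset A, ∀ z : ZeroAtInftyContinuousMap A ℝ, ‖z - x‖ ≤ η / 2 →
      ∀ z' : ZeroAtInftyContinuousMap A ℝ,
        (∀ a ∈ S, z' a = z a) → (∀ a ∉ S, z' a = 0) → shrink hη z = shrink hη z' := by
  refine ⟨(x.finite_setOf_lt_abs (half_pos hη')).toFinset, fun z hz z' h₁ h₂ => ?_⟩
  ext a
  rw [shrink_apply, shrink_apply]
  by_cases ha : η / 2 < |x a|
  · rw [h₁ a (by simpa using ha)]
  · have hza : |z a - x a| ≤ η / 2 := (norm_coe_le (z - x) a).trans hz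
    have hle : |z a| ≤ η := by
      have := abs_sub_abs_le_abs_sub (z a) (x a)
      linarith
    rw [h₂ a (by simpa using ha), softThreshold_eq_zero hle,
      softThreshold_eq_zero (by simpa using hη)]

end shrink

end ZeroAtInftyContinuousMap

section Composition

variable {X Y : Type*} [NormedAddCommGroup X] [NormedAddCommGroup Y]

lemma norm_comp_sub_le {ω : ℝ → ℝ} (hω : Admissible ω) {f : X → Y} {T : X → X}
    (hT : ∀ x y, ‖T x - T y‖ ≤ ‖x - y‖) {M : ℝ} (hM : 0 ≤ M) {x y : X} (hxy : x ≠ y)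
    (h : T x ≠ T y → ‖f (T x) - f (T y)‖ ≤ M * ω ‖T x - T y‖) :
    ‖f (T x) - f (T y)‖ ≤ M * ω ‖x - y‖ := by
  have hpos : 0 < ‖x - y‖ := norm_pos_iff.2 (sub_ne_zero.2 hxy)
  by_cases hne : T x = T y
  · rw [hne, sub_self, norm_zero]
    exact mul_nonneg hM (hω.1 _ hpos).le
  · exact (h hne).trans (mul_le_mul_of_nonneg_left
      (hω.2.1 _ _ (norm_pos_iff.2 (sub_ne_zero.2 hne)) (hT x y)) hM)

lemma HolderFinite.exists_nonneg {ω : ℝ → ℝ} (hω : Admissible ω) {f : X → Y}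
    (hf : HolderFinite ω f) : ∃ M : ℝ, 0 ≤ M ∧ HolderLE ω f M := by
  obtain ⟨M, hM⟩ := hf
  exact ⟨max M 0, le_max_right _ _, fun x y hxy => (hM x y hxy).trans
    (mul_le_mul_of_nonneg_right (le_max_left _ _)
      (hω.1 _ (norm_pos_iff.2 (sub_ne_zero.2 hxy))).le)⟩

/-- Precomposition with a `1`-Lipschitz map preserves `VCsmall`. -/
lemma VCsmall.comp_of_norm_sub_le {ω : ℝ → ℝ} (hω : Admissible ω) {f : X → Y}
    (hf : VCsmall ω f) {T : X → X} (hT : ∀ x y, ‖T x - T y‖ ≤ ‖x - y‖) :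
    VCsmall ω (f ∘ T) := by
  obtain ⟨M, hM, hfM⟩ := hf.1.exists_nonneg hω
  refine ⟨⟨M, fun x y hxy => norm_comp_sub_le hω hT hM hxy (hfM _ _)⟩, fun ε hε => ?_⟩
  obtain ⟨δ, hδ, h⟩ := hf.2 ε hε
  exact ⟨δ, hδ, fun x y hxy hlt => norm_comp_sub_le hω hT hε.le hxy
    fun hne => h _ _ hne ((hT x y).trans_lt hlt)⟩

/-- Precomposing `f ∈ VC_small` with a `1`-Lipschitz map uniformly close to the identity changes
`f` little in the Hölder seminorm. -/
lemma VCsmall.exists_holderLE_comp_sub {ω : ℝ → ℝ} (hω : Admissible ω) {f : X → Y}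
    (hf : VCsmall ω f) {ε : ℝ} (hε : 0 < ε) :
    ∃ η : ℝ, 0 < η ∧ ∀ T : X → X, (∀ x y, ‖T x - T y‖ ≤ ‖x - y‖) → (∀ x, ‖T x - x‖ ≤ η) →
      HolderLE ω (fun x => f (T x) - f x) ε := by
  obtain ⟨M, hM, hfM⟩ := hf.1.exists_nonneg hω
  obtain ⟨δ, hδ, hsmall⟩ := hf.2 (ε / 2) (half_pos hε)
  have hωδ := hω.1 δ hδ
  have hc : 0 < ε / 2 * ω δ / (M + 1) := by positivity
  obtain ⟨η, hηlt, hη⟩ :=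
    ((hω.2.2.1.eventually (gt_mem_nhds hc)).and self_mem_nhdsWithin).exists
  have hη : 0 < η := hη
  have hωη := hω.1 η hη
  have hMη : M * ω η ≤ ε / 2 * ω δ := by
    rw [lt_div_iff₀ (by linarith)] at hηlt
    linarith
  refine ⟨η, hη, fun T hT hTη x y hxy => ?_⟩
  have hclose : ∀ x, ‖f (T x) - f x‖ ≤ ε / 2 * ω δ := fun x => by
    by_cases hne : T x = x
    · rw [hne, sub_self, norm_zero]; positivity
    · exact ((hfM _ _ hne).trans (mul_le_mul_of_nonneg_left
        (hω.2.1 _ _ (norm_pos_iff.2 (sub_ne_zero.2 hne)) (hTη x)) hM)).trans hMη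
  rcases lt_or_ge ‖x - y‖ δ with hlt | hge
  · have h₁ := norm_comp_sub_le hω hT (half_pos hε).le hxy
      fun hne => hsmall _ _ hne ((hT x y).trans_lt hlt)
    have h₂ := hsmall x y hxy hlt
    have h₃ := norm_sub_le (f (T x) - f (T y)) (f x - f y)
    rw [sub_sub_sub_comm] at h₃
    linarith
  · have h₁ := norm_sub_le (f (T x) - f x) (f (T y) - f y)
    have h₂ := mul_le_mul_of_nonneg_left (hω.2.1 _ _ hδ hge) hε.le
    linarith [hclose x, hclose y]

lemma BddSupp.comp_of_norm_sub_self_le {f : X → Y} (hf : BddSupp f) {T : X → X} {η : ℝ}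
    (hT : ∀ x, ‖T x - x‖ ≤ η) : BddSupp (f ∘ T) := by
  obtain ⟨R, hR⟩ := hf
  refine ⟨R + η, fun x hx => hR _ ?_⟩
  have h := norm_sub_norm_le x (T x)
  rw [norm_sub_rev] at h
  linarith [hT x]

end Composition

/-- Lemma 5.7: for `X = c₀(𝒜)` (modelled as `C₀(A,ℝ)` with `A` discrete) and `Y` Banach, every
`f ∈ VC^{0,ω}_small(X,Y)` admits, for each `ε > 0`, an approximation `g ∈ VC^{0,ω}_small(X,Y)`
with `‖g − f‖_{Ċ^{0,ω}} ≤ ε` that locally (on balls of a fixed radius `r > 0`) depends only on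
finitely many coordinates, i.e. `g(z) = g(P_S z)` on `B(x,r)` for a finite `S = S_x ⊆ A`;
moreover `g` inherits bounded support and Lipschitz continuity from `f`. -/
theorem vcsmall_finite_coordinates_approx_c0
    {A : Type*} [TopologicalSpace A] [DiscreteTopology A]
    {Y : Type*} [NormedAddCommGroup Y] [NormedSpace ℝ Y] [CompleteSpace Y]
    (ω : ℝ → ℝ) (hω : Admissible ω)
    (f : ZeroAtInftyContinuousMap A ℝ → Y) (hf : VCsmall ω f)
    (ε : ℝ) (hε : 0 < ε) :
    ∃ (g : ZeroAtInftyContinuousMap A ℝ → Y) (r : ℝ), 0 < r ∧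
      VCsmall ω g ∧
      HolderLE ω (fun x => g x - f x) ε ∧
      (∀ x : ZeroAtInftyContinuousMap A ℝ, ∃ S : Finset A,
        ∀ z : ZeroAtInftyContinuousMap A ℝ, ‖z - x‖ ≤ r →
          ∀ z' : ZeroAtInftyContinuousMap A ℝ,
            (∀ a ∈ S, z' a = z a) → (∀ a ∉ S, z' a = 0) → g z = g z') ∧
      (BddSupp f → BddSupp g) ∧
      ((∃ L, LipschitzWith L f) → ∃ L, LipschitzWith L g) := by
  obtain ⟨η, hη, happrox⟩ := hf.exists_holderLE_comp_sub hω hε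
  have hT := ZeroAtInftyContinuousMap.norm_shrink_sub_le (A := A) hη.le
  have hTη := ZeroAtInftyContinuousMap.norm_shrink_sub_self_le (A := A) hη.le
  refine ⟨f ∘ ZeroAtInftyContinuousMap.shrink hη.le, η / 2, half_pos hη,
    hf.comp_of_norm_sub_le hω hT, happrox _ hT hTη, fun x => ?_,
    fun h => h.comp_of_norm_sub_self_le hTη,
    fun ⟨L, hL⟩ => ⟨L * 1, hL.comp (ZeroAtInftyContinuousMap.lipschitzWith_shrink hη.le)⟩⟩
  obtain ⟨S, hS⟩ := ZeroAtInftyContinuousMap.exists_finset_shrink_eq hη.le hη x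
  exact ⟨S, fun z hz z' h₁ h₂ => congrArg f (hS z hz z' h₁ h₂)⟩
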